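/- Let 0 → K → P → M → 0 be a short exact sequence of finite-dimensional A-modules in which P is projective over A. Then for every r-dimensional subspace U ⊆ V, the restriction α_U^*(M) is free as a C-module if and only if α_U^*(K) is free as a C-module. (Consequently the r-rank variety of the Heller shift Ω(M) coincides with that of M.) -/

import Mathlib

open scoped TensorProduct

set_option synthInstance.maxHeartbeats 1000000
set_option maxHeartbeats 1000000

noncomputable section

def truncIdeal (k : Type*) [Field k] (n p : ℕ) : Ideal (MvPolynomial (Fin n) k) :=
  Ideal.span (Set.range fun i : Fin n => (MvPolynomial.X i : MvPolynomial (Fin n) k) ^ p)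

abbrev TruncAlg (k : Type*) [Field k] (n p : ℕ) :=
  MvPolynomial (Fin n) k ⧸ truncIdeal k n p

def xGen (k : Type*) [Field k] (n p : ℕ) (i : Fin n) : TruncAlg k n p :=
  Ideal.Quotient.mk (truncIdeal k n p) (MvPolynomial.X i)

def radIdeal (k : Type*) [Field k] (n p : ℕ) : Ideal (TruncAlg k n p) :=
  Ideal.span (Set.range (xGen k n p))

def xSpan (k : Type*) [Field k] (n p : ℕ) : Submodule k (TruncAlg k n p) :=
  Submodule.span k (Set.range (xGen k n p))

def IsFreeVia {C A : Type*} [CommRing C] [CommRing A] (α : C →+* A)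
    (M : Type*) [AddCommGroup M] [Module A M] : Prop :=
  letI : Module C M := Module.compHom M α
  Module.Free C M

def smulLinear (k : Type*) {A : Type*} (M : Type*) [CommSemiring k] [Semiring A]
    [AddCommMonoid M] [Module k M] [Module A M] [SMulCommClass k A M] (a : A) :
    M →ₗ[k] M where
  toFun m := a • m
  map_add' x y := smul_add a x y
  map_smul' c m := (smul_comm c a m).symm

def radPow (k A M : Type*) [CommSemiring k] [CommRing A] [AddCommMonoid M]
    [Module k M] [Module A M] [SMulCommClass k A M] (U : Set A) (j : ℕ) :
    Submodule k M :=
  ⨆ (u : Fin j → A) (_ : ∀ i, u i ∈ U), LinearMap.range (smulLinear k M (∏ i, u i))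

def socPow (k A M : Type*) [CommSemiring k] [CommRing A] [AddCommMonoid M]
    [Module k M] [Module A M] [SMulCommClass k A M] (U : Set A) (j : ℕ) :
    Submodule k M :=
  ⨅ (u : Fin j → A) (_ : ∀ i, u i ∈ U), LinearMap.ker (smulLinear k M (∏ i, u i))

section Shift

open IsLocalRing

theorem Module.Free.of_exact_of_residueField_embedding {C K P M : Type*} [CommRing C]
    [IsLocalRing C] [AddCommGroup K] [Module C K] [AddCommGroup P] [Module C P]
    [AddCommGroup M] [Module C M] [Module.Finite C K] [Module.Finite C P]
    [Module.Free C P] [Module.Free C K]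
    (σ : ResidueField C →ₗ[C] C) (hσ : Function.Injective σ)
    (f : K →ₗ[C] P) (g : P →ₗ[C] M)
    (hf : Function.Injective f) (hg : Function.Surjective g) (hfg : Function.Exact f g) :
    Module.Free C M := by
  refine Module.free_of_lTensor_residueField_injective f g hg hfg ?_
  have h1 : Function.Injective (σ.rTensor K) :=
    Module.Flat.rTensor_preserves_injective_linearMap σ hσ
  have h2 : Function.Injective (f.lTensor C) :=
    Module.Flat.lTensor_preserves_injective_linearMap f hf
  have h3 : (σ.rTensor P) ∘ₗ (f.lTensor (ResidueField C)) = (f.lTensor C) ∘ₗ (σ.rTensor K) := by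
    rw [LinearMap.rTensor_comp_lTensor, LinearMap.lTensor_comp_rTensor]
  refine Function.Injective.of_comp (f := σ.rTensor P) ?_
  rw [← LinearMap.coe_comp, h3, LinearMap.coe_comp]
  exact h2.comp h1

theorem Module.Free.kernel_of_exact {C K P M : Type*} [CommRing C]
    [IsLocalRing C] [AddCommGroup K] [Module C K] [AddCommGroup P] [Module C P]
    [AddCommGroup M] [Module C M] [Module.Finite C K]
    [Module.Free C P] [Module.Free C M] (f : K →ₗ[C] P) (g : P →ₗ[C] M)
    (hf : Function.Injective f) (hg : Function.Surjective g) (hfg : Function.Exact f g) :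
    Module.Free C K := by
  obtain ⟨l, hl⟩ := ((hfg.split_tfae hf hg).out 0 1).mp (Module.projective_lifting_property _ _ hg)
  have : Module.Projective C K := Module.Projective.of_split _ _ hl
  exact Module.free_of_flat_of_isLocalRing

theorem exists_residueField_embedding {C : Type*} [CommRing C] [IsLocalRing C] (s : C)
    (hs : ∀ c, c * s = 0 ↔ c ∈ maximalIdeal C) :
    ∃ σ : ResidueField C →ₗ[C] C, Function.Injective σ := by
  have hker : maximalIdeal C = LinearMap.ker (LinearMap.toSpanSingleton C C s) := by
    ext c
    rw [LinearMap.mem_ker, LinearMap.toSpanSingleton_apply, smul_eq_mul, hs]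
  exact ⟨(maximalIdeal C).liftQ (LinearMap.toSpanSingleton C C s) hker.le,
    LinearMap.ker_eq_bot.1 (Submodule.ker_liftQ_eq_bot' _ _ hker)⟩

end Shift

section TruncAlg

variable (k : Type*) [Field k] (n p : ℕ)

theorem mem_truncIdeal_iff (q : MvPolynomial (Fin n) k) :
    q ∈ truncIdeal k n p ↔ ∀ a ∈ q.support, ∃ i, p ≤ a i := by
  have : truncIdeal k n p = Ideal.span ((fun s => MvPolynomial.monomial s (1 : k)) ''
      Set.range fun i : Fin n => Finsupp.single i p) := by
    rw [truncIdeal, ← Set.range_comp]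
    simp only [Function.comp_def, MvPolynomial.X_pow_eq_monomial]
  rw [this, MvPolynomial.mem_ideal_span_monomial_image]
  simp [Finsupp.single_le_iff]

def truncMonomial (a : Fin n → Fin p) : TruncAlg k n p :=
  Ideal.Quotient.mk (truncIdeal k n p)
    (MvPolynomial.monomial (Finsupp.equivFunOnFinite.symm fun i => (a i : ℕ)) 1)

theorem linearIndependent_truncMonomial : LinearIndependent k (truncMonomial k n p) := by
  rw [Fintype.linearIndependent_iff]
  intro c hc b
  by_contra hb
  set q : MvPolynomial (Fin n) k := ∑ a : Fin n → Fin p,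
    MvPolynomial.monomial (Finsupp.equivFunOnFinite.symm fun i => (a i : ℕ)) (c a) with hq
  have hmem : q ∈ truncIdeal k n p := by
    rw [← Ideal.Quotient.eq_zero_iff_mem, ← hc, hq, map_sum]
    refine Finset.sum_congr rfl fun a _ => ?_
    rw [truncMonomial, ← Ideal.Quotient.mkₐ_eq_mk k, ← map_smul, MvPolynomial.smul_monomial]
    simp
  have hcoeff : q.coeff (Finsupp.equivFunOnFinite.symm fun i => (b i : ℕ)) = c b := by
    rw [hq, MvPolynomial.coeff_sum, Finset.sum_eq_single b]
    · simp
    · intro a _ hab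
      rw [MvPolynomial.coeff_monomial, if_neg]
      intro h
      apply hab
      funext i
      exact Fin.ext (congrFun (Finsupp.equivFunOnFinite.symm.injective h) i)
    · simp
  obtain ⟨i, hi⟩ := (mem_truncIdeal_iff k n p q).1 hmem
    (Finsupp.equivFunOnFinite.symm fun i => (b i : ℕ))
    (by rw [MvPolynomial.mem_support_iff, hcoeff]; exact hb)
  exact absurd (b i).isLt (not_lt.2 hi)

theorem span_truncMonomial : ⊤ ≤ Submodule.span k (Set.range (truncMonomial k n p)) := by
  rintro x -
  obtain ⟨q, rfl⟩ := Ideal.Quotient.mk_surjective x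
  rw [q.as_sum, map_sum]
  refine Submodule.sum_mem _ fun a _ => ?_
  by_cases h : ∃ i, p ≤ a i
  · rw [Ideal.Quotient.eq_zero_iff_mem.2]
    · exact zero_mem _
    · rw [mem_truncIdeal_iff]
      intro b hb
      rwa [Finset.mem_singleton.1 (MvPolynomial.support_monomial_subset hb)]
  · push Not at h
    have : Ideal.Quotient.mk (truncIdeal k n p) (MvPolynomial.monomial a (q.coeff a)) =
        q.coeff a • truncMonomial k n p fun i => ⟨a i, h i⟩ := by
      rw [truncMonomial, ← Ideal.Quotient.mkₐ_eq_mk k, ← map_smul, MvPolynomial.smul_monomial]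
      congr 2
      · ext i; simp
      · simp
    rw [this]
    exact Submodule.smul_mem _ _ (Submodule.subset_span ⟨_, rfl⟩)

def truncBasis : Module.Basis (Fin n → Fin p) k (TruncAlg k n p) :=
  .mk (linearIndependent_truncMonomial k n p) (span_truncMonomial k n p)

instance finite_truncAlg : Module.Finite k (TruncAlg k n p) := .of_basis (truncBasis k n p)

theorem finrank_truncAlg : Module.finrank k (TruncAlg k n p) = p ^ n := by
  rw [Module.finrank_eq_card_basis (truncBasis k n p)]
  simp

theorem nontrivial_truncAlg [Fact p.Prime] : Nontrivial (TruncAlg k n p) :=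
  Module.nontrivial_of_finrank_pos (R := k)
    (by rw [finrank_truncAlg]; exact pow_pos (Fact.out : p.Prime).pos n)

theorem xGen_pow (i : Fin n) : xGen k n p i ^ p = 0 := by
  rw [xGen, ← map_pow, Ideal.Quotient.eq_zero_iff_mem]
  exact Ideal.subset_span ⟨i, rfl⟩

theorem pow_eq_zero_of_mem_radIdeal [Fact p.Prime] [CharP k p] {a : TruncAlg k n p}
    (ha : a ∈ radIdeal k n p) : a ^ p = 0 := by
  have hp : p ≠ 0 := (Fact.out : p.Prime).ne_zero
  have := nontrivial_truncAlg k n p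
  have : CharP (TruncAlg k n p) p := charP_of_injective_algebraMap' k p
  induction ha using Submodule.span_induction with
  | mem x h => obtain ⟨i, rfl⟩ := h; exact xGen_pow k n p i
  | zero => exact zero_pow hp
  | add x y _ _ hx hy => rw [add_pow_char, hx, hy, add_zero]
  | smul c x _ hx => rw [smul_eq_mul, mul_pow, hx, mul_zero]

theorem adjoin_xGen : Algebra.adjoin k (Set.range (xGen k n p)) = ⊤ := by
  have : Set.range (xGen k n p) = Ideal.Quotient.mkₐ k (truncIdeal k n p) ''
      Set.range MvPolynomial.X := by
    rw [← Set.range_comp]; rfl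
  rw [this, ← AlgHom.map_adjoin, MvPolynomial.adjoin_range_X, Algebra.map_top,
    AlgHom.range_eq_top]
  exact Ideal.Quotient.mkₐ_surjective _ _

theorem exists_sub_algebraMap_mem_radIdeal (a : TruncAlg k n p) :
    ∃ c : k, a - algebraMap k _ c ∈ radIdeal k n p := by
  have ha : a ∈ Algebra.adjoin k (Set.range (xGen k n p)) := by rw [adjoin_xGen]; trivial
  induction ha using Algebra.adjoin_induction with
  | mem x h => exact ⟨0, by rw [map_zero, sub_zero]; exact Ideal.subset_span h⟩
  | algebraMap c => exact ⟨c, by simp⟩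
  | add x y _ _ hx hy =>
    obtain ⟨c, hc⟩ := hx
    obtain ⟨d, hd⟩ := hy
    refine ⟨c + d, ?_⟩
    rw [map_add, add_sub_add_comm]
    exact add_mem hc hd
  | mul x y _ _ hx hy =>
    obtain ⟨c, hc⟩ := hx
    obtain ⟨d, hd⟩ := hy
    refine ⟨c * d, ?_⟩
    have : x * y - algebraMap k _ (c * d) = y * (x - algebraMap k _ c) +
      algebraMap k _ c * (y - algebraMap k _ d) := by rw [map_mul]; ring
    rw [this]
    exact add_mem (Ideal.mul_mem_left _ _ hc) (Ideal.mul_mem_left _ _ hd)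

theorem isUnit_of_sub_algebraMap_mem [Fact p.Prime] [CharP k p] {a : TruncAlg k n p} {c : k}
    (hc : c ≠ 0) (h : a - algebraMap k _ c ∈ radIdeal k n p) : IsUnit a := by
  have h1 : IsNilpotent (a - algebraMap k _ c) := ⟨p, pow_eq_zero_of_mem_radIdeal k n p h⟩
  have := h1.isUnit_add_left_of_commute ((isUnit_iff_ne_zero.2 hc).map (algebraMap k _))
    (Commute.all _ _)
  simpa using this

theorem isLocalRing_truncAlg [Fact p.Prime] [CharP k p] : IsLocalRing (TruncAlg k n p) := by
  have := nontrivial_truncAlg k n p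
  refine .of_isUnit_or_isUnit_one_sub_self fun a => ?_
  obtain ⟨c, hc⟩ := exists_sub_algebraMap_mem_radIdeal k n p a
  by_cases h : c = 0
  · right
    refine IsNilpotent.isUnit_one_sub ⟨p, pow_eq_zero_of_mem_radIdeal k n p ?_⟩
    simpa [h] using hc
  · exact .inl (isUnit_of_sub_algebraMap_mem k n p h hc)

theorem exists_socle_generator [Fact p.Prime] [CharP k p] [IsLocalRing (TruncAlg k n p)] :
    ∃ s : TruncAlg k n p, ∀ c, c * s = 0 ↔ c ∈ IsLocalRing.maximalIdeal (TruncAlg k n p) := by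
  have hp := (Fact.out : p.Prime).pos
  set s : TruncAlg k n p := ∏ i, xGen k n p i ^ (p - 1) with hs
  have hs0 : s ≠ 0 := by
    have : s = truncMonomial k n p fun _ => ⟨p - 1, by omega⟩ := by
      rw [hs, truncMonomial, MvPolynomial.monomial_eq, map_mul, map_one, map_one, one_mul,
        Finsupp.prod_fintype _ _ (by simp), map_prod]
      simp [xGen]
    rw [this]
    exact (linearIndependent_truncMonomial k n p).ne_zero _
  have hrad : ∀ a ∈ radIdeal k n p, a * s = 0 := by
    intro a ha
    induction ha using Submodule.span_induction with
    | mem x h =>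
      obtain ⟨i, rfl⟩ := h
      rw [hs, ← Finset.mul_prod_erase _ _ (Finset.mem_univ i), ← mul_assoc, ← pow_succ',
        Nat.sub_add_cancel hp, xGen_pow, zero_mul]
    | zero => exact zero_mul _
    | add x y _ _ hx hy => rw [add_mul, hx, hy, add_zero]
    | smul c x _ hx => rw [smul_eq_mul, mul_assoc, hx, mul_zero]
  refine ⟨s, fun a => ⟨fun h => ?_, fun h => ?_⟩⟩
  · rw [IsLocalRing.mem_maximalIdeal, mem_nonunits_iff]
    intro hu
    exact hs0 ((hu.mul_right_eq_zero).1 h)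
  · obtain ⟨c, hc⟩ := exists_sub_algebraMap_mem_radIdeal k n p a
    by_cases h0 : c = 0
    · exact hrad a (by simpa [h0] using hc)
    · exact absurd (isUnit_of_sub_algebraMap_mem k n p h0 hc) h

def truncLift {B : Type*} [CommRing B] [Algebra k B] (w : Fin n → B) (hw : ∀ i, w i ^ p = 0) :
    TruncAlg k n p →ₐ[k] B :=
  Ideal.Quotient.liftₐ _ (MvPolynomial.aeval w) fun a ha => by
    have : truncIdeal k n p ≤ RingHom.ker (MvPolynomial.aeval w : _ →ₐ[k] B) := by
      rw [truncIdeal, Ideal.span_le]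
      rintro _ ⟨i, rfl⟩
      simp [hw]
    exact RingHom.mem_ker.1 (this ha)

theorem truncLift_xGen {B : Type*} [CommRing B] [Algebra k B] (w : Fin n → B)
    (hw : ∀ i, w i ^ p = 0) (i : Fin n) : truncLift k n p w hw (xGen k n p i) = w i := by
  rw [truncLift, xGen, Ideal.Quotient.liftₐ_apply]
  exact MvPolynomial.aeval_X w i

theorem radIdeal_fg : (radIdeal k n p).FG :=
  Submodule.fg_span (Set.finite_range _)

theorem isNilpotent_radIdeal [Fact p.Prime] [CharP k p] : IsNilpotent (radIdeal k n p) :=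
  (Ideal.FG.isNilpotent_iff_le_nilradical (radIdeal_fg k n p)).2
    fun _ ha => ⟨p, pow_eq_zero_of_mem_radIdeal k n p ha⟩

variable {k n p}

theorem finrank_le_of_complement_sq_radIdeal {V : Submodule k (TruncAlg k n p)}
    (hV1 : V ⊓ Submodule.restrictScalars k ((radIdeal k n p) ^ 2 : Ideal (TruncAlg k n p)) = ⊥)
    (hV2 : V ⊔ Submodule.restrictScalars k ((radIdeal k n p) ^ 2 : Ideal (TruncAlg k n p)) =
      Submodule.restrictScalars k (radIdeal k n p)) :
    Module.finrank k V ≤ n := by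
  set S := Submodule.restrictScalars k ((radIdeal k n p) ^ 2 : Ideal (TruncAlg k n p)) with hS
  set X := Submodule.span k (Set.range (xGen k n p)) with hX
  have hle : V ⊔ S ≤ X ⊔ S := by
    rw [hV2]
    intro a ha
    rw [Submodule.restrictScalars_mem] at ha
    induction ha using Submodule.span_induction with
    | mem x h => exact Submodule.mem_sup_left (Submodule.subset_span h)
    | zero => exact zero_mem _
    | add x y _ _ hx hy => exact add_mem hx hy
    | smul b x hx' hx =>
      obtain ⟨c, hc⟩ := exists_sub_algebraMap_mem_radIdeal k n p b
      have : b • x = c • x + (b - algebraMap k _ c) * x := by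
        rw [Algebra.smul_def c x, smul_eq_mul]; ring
      rw [this]
      refine add_mem (Submodule.smul_mem _ _ hx) (Submodule.mem_sup_right ?_)
      rw [hS, Submodule.restrictScalars_mem, pow_two]
      exact Ideal.mul_mem_mul hc hx'
  have h1 := Submodule.finrank_sup_add_finrank_inf_eq V S
  rw [hV1, finrank_bot, add_zero] at h1
  have h2 := Submodule.finrank_mono hle
  have h3 := Submodule.finrank_add_le_finrank_add_finrank X S
  have h4 : Module.finrank k X ≤ n :=
    (finrank_range_le_card (R := k) (xGen k n p)).trans_eq (Fintype.card_fin n)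
  omega

theorem adjoin_eq_top_of_sup_sq_radIdeal [Fact p.Prime] [CharP k p]
    {V : Submodule k (TruncAlg k n p)}
    (hV : V ⊔ Submodule.restrictScalars k ((radIdeal k n p) ^ 2 : Ideal (TruncAlg k n p)) =
      Submodule.restrictScalars k (radIdeal k n p)) :
    Algebra.adjoin k (V : Set (TruncAlg k n p)) = ⊤ := by
  have hnil := isNilpotent_radIdeal k n p
  have hVR : (V : Set (TruncAlg k n p)) ⊆ radIdeal k n p := fun v hv =>
    (hV.le : _ ≤ _) (Submodule.mem_sup_left hv)
  have hJ : radIdeal k n p ≤ Ideal.span (V : Set (TruncAlg k n p)) := by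
    refine Submodule.le_of_le_smul_of_le_jacobson_bot (I := radIdeal k n p)
      (radIdeal_fg k n p) ?_ ?_
    · refine le_trans ?_ (Ideal.radical_le_jacobson (I := ⊥))
      exact fun a ha => ⟨p, pow_eq_zero_of_mem_radIdeal k n p ha⟩
    · intro a ha
      have ha' : a ∈ V ⊔ Submodule.restrictScalars k
          ((radIdeal k n p) ^ 2 : Ideal (TruncAlg k n p)) := by rw [hV]; exact ha
      obtain ⟨v, hv, w, hw, rfl⟩ := Submodule.mem_sup.1 ha'
      refine Submodule.add_mem_sup (Ideal.subset_span hv) ?_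
      rw [smul_eq_mul, ← pow_two]
      exact hw
  obtain ⟨N, hN⟩ := hnil
  set S := Algebra.adjoin k (V : Set (TruncAlg k n p)) with hS
  have key : ∀ j : ℕ, ∀ a : TruncAlg k n p, ∃ b ∈ S, a - b ∈ radIdeal k n p ^ j := by
    intro j
    induction j with
    | zero => exact fun a => ⟨0, zero_mem _, by simp⟩
    | succ j ih =>
      have hR : ∀ a ∈ radIdeal k n p, ∃ b ∈ S, a - b ∈ radIdeal k n p ^ (j + 1) := by
        intro a ha
        have ha' := hJ ha
        induction ha' using Submodule.span_induction with
        | mem x h => exact ⟨x, Algebra.subset_adjoin h, by simp⟩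
        | zero => exact ⟨0, zero_mem _, by simp⟩
        | add x y hx' hy' hx hy =>
          have hle : Ideal.span (V : Set (TruncAlg k n p)) ≤ radIdeal k n p :=
            Ideal.span_le.2 hVR
          obtain ⟨b, hb, hb'⟩ := hx (hle hx')
          obtain ⟨c, hc, hc'⟩ := hy (hle hy')
          refine ⟨b + c, add_mem hb hc, ?_⟩
          rw [add_sub_add_comm]
          exact add_mem hb' hc'
        | smul c x hx' hx =>
          have hxR : x ∈ radIdeal k n p := Ideal.span_le.2 hVR hx'
          obtain ⟨b, hb, hb'⟩ := hx hxR
          obtain ⟨d, hd, hd'⟩ := ih c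
          refine ⟨d * b, mul_mem hd hb, ?_⟩
          have : c • x - d * b = (c - d) * x + d * (x - b) := by rw [smul_eq_mul]; ring
          rw [this]
          refine add_mem ?_ (Ideal.mul_mem_left _ _ hb')
          exact (pow_succ (radIdeal k n p) j).ge (Ideal.mul_mem_mul hd' hxR)
      intro a
      obtain ⟨c, hc⟩ := exists_sub_algebraMap_mem_radIdeal k n p a
      obtain ⟨b, hb, hb'⟩ := hR _ hc
      refine ⟨algebraMap k _ c + b, add_mem (S.algebraMap_mem c) hb, ?_⟩
      rwa [← sub_sub]
  rw [eq_top_iff]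
  rintro a -
  obtain ⟨b, hb, hb'⟩ := key N a
  rw [hN] at hb'
  rwa [sub_eq_zero.1 hb']

theorem exists_complementary_family {B : Type*} [AddCommGroup B] [Module k B]
    {V : Submodule k B} [FiniteDimensional k V] {r : ℕ} (u : Fin r → B) (hu : ∀ i, u i ∈ V)
    (hind : LinearIndependent k u) :
    ∃ (e : ℕ) (w : Fin e → B), r + e = Module.finrank k V ∧ (∀ j, w j ∈ V) ∧
      V ≤ Submodule.span k (Set.range u) ⊔ Submodule.span k (Set.range w) := by
  set u' : Fin r → V := fun i => ⟨u i, hu i⟩ with hu'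
  have hind' : LinearIndependent k u' := .of_comp V.subtype hind
  obtain ⟨W, hW⟩ := (Submodule.span k (Set.range u')).exists_isCompl
  let b := Module.finBasis k W
  refine ⟨Module.finrank k W, fun j => ((b j : V) : B), ?_, fun j => (b j : V).2, ?_⟩
  · rw [← Submodule.finrank_add_eq_of_isCompl hW, finrank_span_eq_card hind', Fintype.card_fin]
  · have h1 : Submodule.map V.subtype (Submodule.span k (Set.range u')) =
        Submodule.span k (Set.range u) := by
      rw [Submodule.map_span, ← Set.range_comp]; rfl
    have h2 : Submodule.map V.subtype W =
        Submodule.span k (Set.range fun j => ((b j : V) : B)) := by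
      have h3 : Submodule.map W.subtype (Submodule.span k (Set.range b)) = W := by
        rw [b.span_eq, Submodule.map_subtype_top]
      conv_lhs => rw [← h3]
      rw [Submodule.map_span, Submodule.map_span, ← Set.range_comp, ← Set.range_comp]; rfl
    rw [← h1, ← h2, ← Submodule.map_sup, hW.sup_eq_top, Submodule.map_subtype_top]

theorem free_truncAlg_of_linearIndependent [Fact p.Prime] [CharP k p] {r : ℕ}
    {V : Submodule k (TruncAlg k n p)}
    (hV1 : V ⊓ Submodule.restrictScalars k ((radIdeal k n p) ^ 2 : Ideal (TruncAlg k n p)) = ⊥)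
    (hV2 : V ⊔ Submodule.restrictScalars k ((radIdeal k n p) ^ 2 : Ideal (TruncAlg k n p)) =
      Submodule.restrictScalars k (radIdeal k n p))
    (u : Fin r → TruncAlg k n p) (hu : ∀ i, u i ∈ V) (hind : LinearIndependent k u)
    [Algebra (TruncAlg k r p) (TruncAlg k n p)]
    [IsScalarTower k (TruncAlg k r p) (TruncAlg k n p)]
    (hα : ∀ i, algebraMap (TruncAlg k r p) (TruncAlg k n p) (xGen k r p i) = u i) :
    Module.Free (TruncAlg k r p) (TruncAlg k n p) := by
  obtain ⟨e, w, hre, hw, hVw⟩ := exists_complementary_family u hu hind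
  have hwp : ∀ j, w j ^ p = 0 := fun j => pow_eq_zero_of_mem_radIdeal k n p
    ((hV2.le : _ ≤ _) (Submodule.mem_sup_left (hw j)))
  let T : TruncAlg k r p ⊗[k] TruncAlg k e p →ₐ[TruncAlg k r p] TruncAlg k n p :=
    Algebra.TensorProduct.productLeftAlgHom (Algebra.ofId _ _) (truncLift k e p w hwp)
  let T' := T.restrictScalars k
  have hsurj : Function.Surjective T' := by
    rw [← AlgHom.range_eq_top, eq_top_iff, ← adjoin_eq_top_of_sup_sq_radIdeal hV2,
      Algebra.adjoin_le_iff]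
    refine le_trans (b := Subalgebra.toSubmodule T'.range) (hVw.trans (sup_le ?_ ?_)) le_rfl
    · rw [Submodule.span_le]
      rintro _ ⟨i, rfl⟩
      refine ⟨xGen k r p i ⊗ₜ 1, ?_⟩
      simp [T', T, Algebra.ofId_apply, hα]
    · rw [Submodule.span_le]
      rintro _ ⟨j, rfl⟩
      refine ⟨1 ⊗ₜ xGen k e p j, ?_⟩
      simp [T', T, truncLift_xGen]
  have hle : Module.finrank k (TruncAlg k r p ⊗[k] TruncAlg k e p) ≤
      Module.finrank k (TruncAlg k n p) := by
    rw [Module.finrank_tensorProduct]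
    simp only [finrank_truncAlg]
    rw [← pow_add, hre]
    exact Nat.pow_le_pow_right (Fact.out : p.Prime).pos
      (finrank_le_of_complement_sq_radIdeal hV1 hV2)
  have heq := le_antisymm hle (LinearMap.finrank_le_finrank_of_surjective (f := T'.toLinearMap) hsurj)
  have hinj : Function.Injective T' :=
    (LinearMap.injective_iff_surjective_of_finrank_eq_finrank (f := T'.toLinearMap) heq).2 hsurj
  exact Module.Free.of_equiv (LinearEquiv.ofBijective T.toLinearMap ⟨hinj, hsurj⟩)

end TruncAlg

/-- If `0 → K → P → M → 0` is a short exact sequence of finite-dimensional `A`-modules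
with `P` projective over `A`, then for every `r`-dimensional subspace `U ⊆ V`,
`α_U^*(M)` is free over `C` iff `α_U^*(K)` is free over `C` (so the `r`-rank variety of
the Heller shift `Ω(M)` coincides with that of `M`). -/
theorem statement5 {k : Type*} [Field k] [IsAlgClosed k] (p n r : ℕ) [Fact p.Prime]
    [CharP k p]
    (V : Submodule k (TruncAlg k n p))
    (hV1 : V ⊓ Submodule.restrictScalars k ((radIdeal k n p) ^ 2 : Ideal (TruncAlg k n p)) = ⊥)
    (hV2 : V ⊔ Submodule.restrictScalars k ((radIdeal k n p) ^ 2 : Ideal (TruncAlg k n p)) =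
      Submodule.restrictScalars k (radIdeal k n p))
    (K P M : Type*)
    [AddCommGroup K] [Module k K] [Module (TruncAlg k n p) K]
    [IsScalarTower k (TruncAlg k n p) K] [FiniteDimensional k K]
    [AddCommGroup P] [Module k P] [Module (TruncAlg k n p) P]
    [IsScalarTower k (TruncAlg k n p) P] [FiniteDimensional k P]
    [AddCommGroup M] [Module k M] [Module (TruncAlg k n p) M]
    [IsScalarTower k (TruncAlg k n p) M] [FiniteDimensional k M]
    (hP : Module.Projective (TruncAlg k n p) P)
    (f : K →ₗ[TruncAlg k n p] P) (g : P →ₗ[TruncAlg k n p] M)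
    (hf : Function.Injective f) (hg : Function.Surjective g)
    (hfg : Function.Exact f g)
    (u : Fin r → TruncAlg k n p) (hu : ∀ i, u i ∈ V) (hind : LinearIndependent k u)
    (α : TruncAlg k r p →ₐ[k] TruncAlg k n p) (hα : ∀ i, α (xGen k r p i) = u i) :
    IsFreeVia α.toRingHom M ↔ IsFreeVia α.toRingHom K := by
  let _ : Algebra (TruncAlg k r p) (TruncAlg k n p) := α.toRingHom.toAlgebra
  let _ : Module (TruncAlg k r p) K := Module.compHom K α.toRingHom
  let _ : Module (TruncAlg k r p) P := Module.compHom P α.toRingHom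
  let _ : Module (TruncAlg k r p) M := Module.compHom M α.toRingHom
  change Module.Free (TruncAlg k r p) M ↔ Module.Free (TruncAlg k r p) K
  have : IsScalarTower k (TruncAlg k r p) (TruncAlg k n p) :=
    ⟨fun c a b => by
      change α (c • a) * b = c • (α a * b)
      rw [map_smul, smul_mul_assoc]⟩
  have : IsScalarTower (TruncAlg k r p) (TruncAlg k n p) K :=
    ⟨fun c a x => mul_smul (α c) a x⟩
  have : IsScalarTower (TruncAlg k r p) (TruncAlg k n p) P :=
    ⟨fun c a x => mul_smul (α c) a x⟩
  have : IsScalarTower (TruncAlg k r p) (TruncAlg k n p) M :=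
    ⟨fun c a x => mul_smul (α c) a x⟩
  have : IsScalarTower k (TruncAlg k r p) K :=
    ⟨fun c a x => by
      change α (c • a) • x = c • (α a • x)
      rw [map_smul, smul_assoc]⟩
  have : IsScalarTower k (TruncAlg k r p) P :=
    ⟨fun c a x => by
      change α (c • a) • x = c • (α a • x)
      rw [map_smul, smul_assoc]⟩
  have : Module.Finite (TruncAlg k r p) K := .of_restrictScalars_finite k _ _
  have : Module.Finite (TruncAlg k r p) P := .of_restrictScalars_finite k _ _
  have := isLocalRing_truncAlg k r p
  have : Module.Free (TruncAlg k r p) (TruncAlg k n p) :=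
    free_truncAlg_of_linearIndependent hV1 hV2 u hu hind hα
  have : Module.Flat (TruncAlg k r p) P := .trans (TruncAlg k r p) (TruncAlg k n p) P
  have : Module.Free (TruncAlg k r p) P := Module.free_of_flat_of_isLocalRing
  obtain ⟨s, hs⟩ := exists_socle_generator k r p
  obtain ⟨σ, hσ⟩ := exists_residueField_embedding s hs
  constructor
  · intro _
    exact Module.Free.kernel_of_exact (f.restrictScalars (TruncAlg k r p))
      (g.restrictScalars (TruncAlg k r p)) hf hg hfg
  · intro _
    exact Module.Free.of_exact_of_residueField_embedding σ hσ
      (f.restrictScalars (TruncAlg k r p)) (g.restrictScalars (TruncAlg k r p)) hf hg hfg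

end
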